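/- In a finite bipartite graph G=(A,B,E), ker_A(G) ∩ N(ker_B(G)) = ∅ and N(ker_A(G)) ∩ ker_B(G) = ∅. -/

import Mathlib

open Finset

open scoped Classical

variable {V : Type*} [Fintype V] [DecidableEq V]

/-- The neighborhood `N(X)` of a finite set of vertices `X`. -/
noncomputable def nbr (G : SimpleGraph V) (X : Finset V) : Finset V :=
  Finset.univ.filter fun v => ∃ x ∈ X, G.Adj v x

/-- The difference `d(X) = |X| - |N(X)|` of a set of vertices. -/
noncomputable def diffZ (G : SimpleGraph V) (X : Finset V) : ℤ :=
  (X.card : ℤ) - ((nbr G X).card : ℤ)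

/-- The critical difference `d_c(G) = max {d(X) : X ⊆ V}`. -/
noncomputable def critDiff (G : SimpleGraph V) : ℤ :=
  (Finset.univ : Finset V).powerset.sup' (Finset.powerset_nonempty _) (diffZ G)

/-- A set of vertices is independent if no two of its vertices are adjacent. -/
def IsIndep (G : SimpleGraph V) (S : Finset V) : Prop :=
  ∀ u ∈ S, ∀ v ∈ S, ¬ G.Adj u v

/-- The independence number `α(G)`. -/
noncomputable def indepNum (G : SimpleGraph V) : ℕ :=
  ((Finset.univ : Finset V).powerset.filter (IsIndep G)).sup Finset.card

/-- The critical independence difference `id_c(G) = max {d(I) : I independent}`. -/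
noncomputable def idc (G : SimpleGraph V) : ℤ :=
  ((Finset.univ : Finset V).powerset.filter (IsIndep G)).sup'
    ⟨∅, by simp [IsIndep]⟩ (diffZ G)

/-- A critical independent set: an independent set `S` with `d(S) = id_c(G)`. -/
def CritIndep (G : SimpleGraph V) (S : Finset V) : Prop :=
  IsIndep G S ∧ diffZ G S = idc G

/-- A finite set of edges of `G` that are pairwise non-incident (a matching). -/
def IsMatchingSet (G : SimpleGraph V) (M : Finset (Sym2 V)) : Prop :=
  (∀ e ∈ M, e ∈ G.edgeSet) ∧
    (M : Set (Sym2 V)).Pairwise fun e f => ∀ v : V, ¬(v ∈ e ∧ v ∈ f)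

/-- The matching number `μ(G)`. -/
noncomputable def matchNum (G : SimpleGraph V) : ℕ :=
  ((Finset.univ : Finset (Sym2 V)).powerset.filter (IsMatchingSet G)).sup Finset.card

/-- A maximum independent set. -/
def IsMaxIndep (G : SimpleGraph V) (S : Finset V) : Prop :=
  IsIndep G S ∧ S.card = indepNum G

/-- `ker(G)`: the intersection of all critical independent sets. -/
noncomputable def kerSet (G : SimpleGraph V) : Finset V :=
  Finset.univ.filter fun v => ∀ S : Finset V, CritIndep G S → v ∈ S

/-- `diadem(G)`: the union of all critical independent sets. -/
noncomputable def diademSet (G : SimpleGraph V) : Finset V :=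
  Finset.univ.filter fun v => ∃ S : Finset V, CritIndep G S ∧ v ∈ S

/-- `core(G)`: the intersection of all maximum independent sets. -/
noncomputable def coreSet (G : SimpleGraph V) : Finset V :=
  Finset.univ.filter fun v => ∀ S : Finset V, IsMaxIndep G S → v ∈ S

/-- `corona(G)`: the union of all maximum independent sets. -/
noncomputable def coronaSet (G : SimpleGraph V) : Finset V :=
  Finset.univ.filter fun v => ∃ S : Finset V, IsMaxIndep G S ∧ v ∈ S

/-- `δ₀(A) = max {δ(X) : X ⊆ A}`, the maximum deficiency over subsets of a side. -/
noncomputable def delta0 (G : SimpleGraph V) (A : Finset V) : ℤ :=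
  A.powerset.sup' (Finset.powerset_nonempty _) (diffZ G)

/-- An `A`-critical set: a subset `X ⊆ A` with `δ(X) = δ₀(A)`. -/
def SideCrit (G : SimpleGraph V) (A X : Finset V) : Prop :=
  X ⊆ A ∧ diffZ G X = delta0 G A

/-- `ker_A(G)`: the intersection of all `A`-critical sets. -/
noncomputable def kerSide (G : SimpleGraph V) (A : Finset V) : Finset V :=
  Finset.univ.filter fun v => ∀ X : Finset V, SideCrit G A X → v ∈ X

/-- `diadem_A(G)`: the union of all `A`-critical sets. -/
noncomputable def diademSide (G : SimpleGraph V) (A : Finset V) : Finset V :=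
  Finset.univ.filter fun v => ∃ X : Finset V, SideCrit G A X ∧ v ∈ X

/-- `{A, B}` is a bipartition of `G`: both sides nonempty, disjoint, covering all
vertices, and every edge goes between `A` and `B`. -/
def IsBipartition (G : SimpleGraph V) (A B : Finset V) : Prop :=
  A.Nonempty ∧ B.Nonempty ∧ Disjoint A B ∧ A ∪ B = Finset.univ ∧
    ∀ u v : V, G.Adj u v → (u ∈ A ∧ v ∈ B) ∨ (u ∈ B ∧ v ∈ A)

theorem mem_nbr_iff {G : SimpleGraph V} {X : Finset V} {v : V} :
    v ∈ nbr G X ↔ ∃ x ∈ X, G.Adj v x := by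
  simp [nbr]

theorem nbr_mono {G : SimpleGraph V} {X Y : Finset V} (h : X ⊆ Y) : nbr G X ⊆ nbr G Y := by
  intro v hv
  obtain ⟨x, hx, hadj⟩ := mem_nbr_iff.1 hv
  exact mem_nbr_iff.2 ⟨x, h hx, hadj⟩

theorem exists_sideCrit (G : SimpleGraph V) (A : Finset V) : ∃ X, SideCrit G A X := by
  obtain ⟨X, hX, h⟩ :=
    Finset.exists_mem_eq_sup' (Finset.powerset_nonempty A) (diffZ G)
  exact ⟨X, Finset.mem_powerset.1 hX, h.symm⟩

theorem diffZ_le_delta0 {G : SimpleGraph V} {A X : Finset V} (h : X ⊆ A) :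
    diffZ G X ≤ delta0 G A :=
  Finset.le_sup' (diffZ G) (Finset.mem_powerset.2 h)

theorem kerSide_subset {G : SimpleGraph V} {A X : Finset V} (hX : SideCrit G A X) :
    kerSide G A ⊆ X := by
  intro v hv
  simp only [kerSide, Finset.mem_filter] at hv
  exact hv.2 X hX

/-- Removing `N(Y)` from `X` also removes `Y` from `N(X)`. -/
theorem nbr_sdiff_nbr_subset (G : SimpleGraph V) (X Y : Finset V) :
    nbr G (X \ nbr G Y) ⊆ nbr G X \ Y := by
  intro v hv
  obtain ⟨x, hx, hadj⟩ := mem_nbr_iff.1 hv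
  rw [Finset.mem_sdiff] at hx ⊢
  exact ⟨mem_nbr_iff.2 ⟨x, hx.1, hadj⟩, fun hvY => hx.2 (mem_nbr_iff.2 ⟨v, hvY, hadj.symm⟩)⟩

theorem le_diffZ_sdiff_nbr (G : SimpleGraph V) (X Y : Finset V) :
    diffZ G X - ((X ∩ nbr G Y).card : ℤ) + ((Y ∩ nbr G X).card : ℤ) ≤
      diffZ G (X \ nbr G Y) := by
  have hle := Finset.card_le_card (nbr_sdiff_nbr_subset G X Y)
  have hX := Finset.card_sdiff_add_card_inter X (nbr G Y)
  have hN := Finset.card_sdiff_add_card_inter (nbr G X) Y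
  rw [Finset.inter_comm (nbr G X) Y] at hN
  unfold diffZ
  omega

/-- If `X` is `A`-critical and `Y` is `B`-critical, then `X \ N(Y)` is `A`-critical. -/
theorem SideCrit.sdiff_nbr {G : SimpleGraph V} {A B X Y : Finset V}
    (hX : SideCrit G A X) (hY : SideCrit G B Y) : SideCrit G A (X \ nbr G Y) := by
  have hXA : X \ nbr G Y ⊆ A := Finset.sdiff_subset.trans hX.1
  have hYB : Y \ nbr G X ⊆ B := Finset.sdiff_subset.trans hY.1
  refine ⟨hXA, le_antisymm (diffZ_le_delta0 hXA) ?_⟩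
  have h₁ := le_diffZ_sdiff_nbr G X Y
  have h₂ := le_diffZ_sdiff_nbr G Y X
  have h₃ := diffZ_le_delta0 (G := G) hYB
  rw [hX.2] at h₁
  rw [hY.2] at h₂
  linarith

theorem kerSide_inter_nbr_kerSide (G : SimpleGraph V) (A B : Finset V) :
    kerSide G A ∩ nbr G (kerSide G B) = ∅ := by
  obtain ⟨X, hX⟩ := exists_sideCrit G A
  obtain ⟨Y, hY⟩ := exists_sideCrit G B
  refine Finset.disjoint_iff_inter_eq_empty.1 ?_
  exact Finset.sdiff_disjoint.mono (kerSide_subset (hX.sdiff_nbr hY))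
    (nbr_mono (kerSide_subset hY))

/-- In a finite bipartite graph,
`ker_A(G) ∩ N(ker_B(G)) = ∅` and `N(ker_A(G)) ∩ ker_B(G) = ∅`. -/
theorem kerSideA_inter_nbr_kerSideB (G : SimpleGraph V) (A B : Finset V)
    (hbip : IsBipartition G A B) :
    kerSide G A ∩ nbr G (kerSide G B) = ∅ ∧
      nbr G (kerSide G A) ∩ kerSide G B = ∅ := by
  refine ⟨kerSide_inter_nbr_kerSide G A B, ?_⟩
  rw [Finset.inter_comm]
  exact kerSide_inter_nbr_kerSide G B A
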